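/- arXiv:2106.07297 — 3 statements merged into one kernel-verified Lean document; each statement's English description precedes it below -/
import Mathlib

section
/- Full expressiveness of MLP-BoxE (Corollary 4.1): Let E, C, R be finite sets of entities, classes, and relations, let x : E → ℝ^k be any feature map, and set d = |E|·|R| + |C|. Then for any two functions f_p, f_b : ℝ^k → ℝ^d (in particular, any multi-layer perceptrons) and for any disjoint sets T and F of facts over this vocabulary, there exist entity embedding vectors ē(e), b̄(e) ∈ ℝ^d for each e ∈ E, a box (l(c), u(c)) in ℝ^d for each class c ∈ C, and head and tail boxes in ℝ^d for each relation r ∈ R, such that in the induced BoxE configuration with pos(e) = ē(e) + f_p(x(e)) and bump(e) = b̄(e) + f_b(x(e)), every fact in T is true and every fact in F is false. -/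
/-- A fact over a vocabulary of entities `E`, classes `C`, and relations `R`:
either a unary fact `c(e)` or a binary fact `r(e_h, e_t)`. -/
inductive BoxE.Fact (E C R : Type*) : Type _ where
  | unary  (c : C) (e : E) : BoxE.Fact E C R
  | binary (r : R) (eh et : E) : BoxE.Fact E C R

namespace BoxE

/-- A point `p` lies in the box with lower corner `l` and upper corner `u`. -/
def inBox {d : ℕ} (l u p : Fin d → ℝ) : Prop :=
  ∀ k : Fin d, l k ≤ p k ∧ p k ≤ u k

/-- A BoxE configuration of dimension `d`: positions and bumps for entities,
a box for each class, and head and tail boxes for each relation. -/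
structure Config (E C R : Type*) (d : ℕ) where
  pos   : E → Fin d → ℝ
  bump  : E → Fin d → ℝ
  clsL  : C → Fin d → ℝ
  clsU  : C → Fin d → ℝ
  headL : R → Fin d → ℝ
  headU : R → Fin d → ℝ
  tailL : R → Fin d → ℝ
  tailU : R → Fin d → ℝ

/-- Truth of a fact in a BoxE configuration. -/
def Config.holds {E C R : Type*} {d : ℕ} (W : Config E C R d) : Fact E C R → Prop
  | .unary c e => inBox (W.clsL c) (W.clsU c) (W.pos e)
  | .binary r eh et =>
      inBox (W.headL r) (W.headU r) (W.pos eh + W.bump et) ∧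
      inBox (W.tailL r) (W.tailU r) (W.pos et + W.bump eh)

end BoxE

namespace BoxE

open Classical in
/-- A configuration with one coordinate per pair in `E × R` and one per class, in which exactly
the facts of `T` hold. Coordinate `(a, r)` refutes the facts `r(e, a)` outside `T`, and
coordinate `c` refutes the facts `c(e)` outside `T`; no coordinate refutes anything else. -/
noncomputable def Config.ofFacts {E C R : Type*} {d : ℕ} (i : Fin d ≃ (E × R) ⊕ C)
    (T : Set (Fact E C R)) : Config E C R d where
  pos e k := match i k with
    | .inl (a, r) => if Fact.binary r e a ∈ T then 0 else 1
    | .inr c => if Fact.unary c e ∈ T then 0 else 1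
  bump e k := match i k with
    | .inl (a, _) => if e = a then 2 else 0
    | .inr _ => 0
  clsL _ _ := 0
  clsU c k := match i k with
    | .inl _ => 3
    | .inr c' => if c = c' then 0 else 3
  headL _ _ := 0
  headU r k := match i k with
    | .inl (_, r') => if r = r' then 2 else 3
    | .inr _ => 3
  tailL _ _ := 0
  tailU _ _ := 3

theorem Config.ofFacts_holds_iff {E C R : Type*} {d : ℕ} (i : Fin d ≃ (E × R) ⊕ C)
    (T : Set (Fact E C R)) (f : Fact E C R) : (ofFacts i T).holds f ↔ f ∈ T := by
  classical
  cases f with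
  | unary c e =>
    constructor
    · intro h
      by_contra hf
      have := (h (i.symm (.inr c))).2
      norm_num [ofFacts, hf] at this
    · intro hf k
      dsimp only [ofFacts]
      rcases i k with ⟨a, r⟩ | c' <;> dsimp only <;> constructor <;> split_ifs <;> simp_all
  | binary r eh et =>
    constructor
    · rintro ⟨h, -⟩
      by_contra hf
      have := (h (i.symm (.inl (et, r)))).2
      norm_num [ofFacts, hf] at this
    · intro hf
      constructor <;> intro k <;> dsimp only [ofFacts, Pi.add_apply] <;>
        rcases i k with ⟨a, r'⟩ | c' <;> dsimp only <;> constructor <;> split_ifs <;>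
        first | (norm_num; done) | simp_all

end BoxE

/-- **Corollary 4.1, full expressiveness of MLP-BoxE.**
For finite `E`, `C`, `R`, any feature map `x : E → ℝ^k`, any point and bump
MLPs `fp fb : ℝ^k → ℝ^d` with `d = |E|·|R| + |C|`, and any disjoint sets `T`
and `F` of facts, there exist entity embeddings and boxes such that in the
induced BoxE configuration (with `pos e = ē e + fp (x e)` and
`bump e = b̄ e + fb (x e)`) every fact of `T` is true and every fact of `F`
is false. -/
theorem mlp_boxe_fully_expressive
    {E C R : Type*} [Fintype E] [Fintype C] [Fintype R]
    {k : ℕ} (x : E → Fin k → ℝ)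
    {d : ℕ} (hd : d = Fintype.card E * Fintype.card R + Fintype.card C)
    (fp fb : (Fin k → ℝ) → Fin d → ℝ)
    (T F : Set (BoxE.Fact E C R)) (hTF : Disjoint T F) :
    ∃ (ebar bbar : E → Fin d → ℝ)
      (clsL clsU : C → Fin d → ℝ)
      (headL headU tailL tailU : R → Fin d → ℝ),
      (∀ f ∈ T, BoxE.Config.holds
        { pos := fun e => ebar e + fp (x e),
          bump := fun e => bbar e + fb (x e),
          clsL := clsL, clsU := clsU,
          headL := headL, headU := headU,
          tailL := tailL, tailU := tailU } f) ∧
      (∀ f ∈ F, ¬ BoxE.Config.holds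
        { pos := fun e => ebar e + fp (x e),
          bump := fun e => bbar e + fb (x e),
          clsL := clsL, clsU := clsU,
          headL := headL, headU := headU,
          tailL := tailL, tailU := tailU } f) := by
  have i : Fin d ≃ (E × R) ⊕ C := (Fintype.equivFinOfCardEq (by simp [hd])).symm
  let W := BoxE.Config.ofFacts i T
  refine ⟨fun e => W.pos e - fp (x e), fun e => W.bump e - fb (x e), W.clsL, W.clsU,
    W.headL, W.headU, W.tailL, W.tailU, ?_⟩
  simp only [sub_add_cancel]
  exact ⟨fun f hf => (BoxE.Config.ofFacts_holds_iff i T f).2 hf,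
    fun f hf h => Set.disjoint_left.1 hTF ((BoxE.Config.ofFacts_holds_iff i T f).1 h) hf⟩
end

section
/- Extension of a BoxE configuration to capture unary facts: Let E, C, R be finite sets of entities, classes, and relations, and suppose a BoxE configuration of dimension d over E and R makes every binary fact of a set T_bin true and every binary fact of a set F_bin false (where T_bin and F_bin are disjoint). Then for any disjoint sets T_un and F_un of unary facts over E and C, there exists a BoxE configuration of dimension d + |C| in which every fact of T_bin ∪ T_un is true and every fact of F_bin ∪ F_un is false. -/
namespace BoxE

theorem inBox_append {m n : ℕ} (l u p : Fin m → ℝ) (l' u' p' : Fin n → ℝ) :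
    inBox (Fin.append l l') (Fin.append u u') (Fin.append p p') ↔
      inBox l u p ∧ inBox l' u' p' := by
  refine ⟨fun h => ⟨fun k => ?_, fun k => ?_⟩, fun h k => ?_⟩
  · simpa using h (Fin.castAdd n k)
  · simpa using h (Fin.natAdd m k)
  · refine Fin.addCases (fun i => ?_) (fun i => ?_) k
    · simpa using h.1 i
    · simpa using h.2 i

theorem append_add_append {m n : ℕ} (p q : Fin m → ℝ) (p' q' : Fin n → ℝ) :
    Fin.append p p' + Fin.append q q' = Fin.append (p + q) (p' + q') := by
  funext k
  refine Fin.addCases (fun i => ?_) (fun i => ?_) k <;> simp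

namespace Config

variable {E C R : Type*}

/-- The configuration whose coordinates are those of `V` followed by those of `W`. -/
def append {m n : ℕ} (V : Config E C R m) (W : Config E C R n) : Config E C R (m + n) where
  pos e := Fin.append (V.pos e) (W.pos e)
  bump e := Fin.append (V.bump e) (W.bump e)
  clsL c := Fin.append (V.clsL c) (W.clsL c)
  clsU c := Fin.append (V.clsU c) (W.clsU c)
  headL r := Fin.append (V.headL r) (W.headL r)
  headU r := Fin.append (V.headU r) (W.headU r)
  tailL r := Fin.append (V.tailL r) (W.tailL r)
  tailU r := Fin.append (V.tailU r) (W.tailU r)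

theorem holds_append {m n : ℕ} (V : Config E C R m) (W : Config E C R n) (f : Fact E C R) :
    (V.append W).holds f ↔ V.holds f ∧ W.holds f := by
  cases f with
  | unary c e => exact inBox_append ..
  | binary r eh et =>
    simp only [holds, append, append_add_append, inBox_append]
    tauto

/-- Replace every class box by one that contains the positions of all entities. -/
def widenClasses [Fintype E] {d : ℕ} (W : Config E C R d) : Config E C R d :=
  { W with
    clsL := fun _ k => -∑ e, |W.pos e k|
    clsU := fun _ k => ∑ e, |W.pos e k| }

theorem widenClasses_holds_unary [Fintype E] {d : ℕ} (W : Config E C R d) (c : C) (e : E) :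
    W.widenClasses.holds (.unary c e) := fun k =>
  abs_le.mp <| Finset.single_le_sum (f := fun e => |W.pos e k|)
    (fun _ _ => abs_nonneg _) (Finset.mem_univ e)

theorem widenClasses_holds_binary [Fintype E] {d : ℕ} (W : Config E C R d) (r : R) (eh et : E) :
    W.widenClasses.holds (.binary r eh et) ↔ W.holds (.binary r eh et) :=
  Iff.rfl

open Classical in
/-- The configuration with one coordinate per class, in which the position of an entity is the
indicator vector of its classes according to `T`. -/
noncomputable def ofUnary [Fintype C] (T : Set (C × E)) : Config E C R (Fintype.card C) where
  pos e k := if ((Fintype.equivFin C).symm k, e) ∈ T then 1 else 0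
  bump _ := 0
  clsL c k := if (Fintype.equivFin C).symm k = c then 1 else 0
  clsU _ := 1
  headL _ := 0
  headU _ := 1
  tailL _ := 0
  tailU _ := 1

theorem ofUnary_holds_unary [Fintype C] (T : Set (C × E)) (c : C) (e : E) :
    (ofUnary T : Config E C R _).holds (.unary c e) ↔ (c, e) ∈ T := by
  constructor
  · intro h
    by_contra hT
    have := (h (Fintype.equivFin C c)).1
    simp [ofUnary, hT] at this
    linarith
  · intro hT k
    simp only [ofUnary, Pi.one_apply]
    split_ifs <;> simp_all

theorem ofUnary_holds_binary [Fintype C] (T : Set (C × E)) (r : R) (eh et : E) :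
    (ofUnary T : Config E C R _).holds (.binary r eh et) := by
  constructor <;> intro k <;> simp only [ofUnary, Pi.add_apply, Pi.zero_apply, Pi.one_apply] <;>
    split_ifs <;> simp

end Config

end BoxE

/-- **extension of a BoxE configuration to capture unary facts.**
If a BoxE configuration of dimension `d` makes every binary fact of `Tbin`
true and every binary fact of `Fbin` false, then for any disjoint sets
`Tun`, `Fun` of unary facts there is a configuration of dimension `d + |C|`
making every fact of `Tbin ∪ Tun` true and every fact of `Fbin ∪ Fun` false. -/
theorem boxe_extend_to_unary
    {E C R : Type*} [Fintype E] [Fintype C] [Fintype R]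
    {d : ℕ} (W : BoxE.Config E C R d)
    (Tbin Fbin : Set (R × E × E)) (hbin : Disjoint Tbin Fbin)
    (hTbin : ∀ p ∈ Tbin, W.holds (.binary p.1 p.2.1 p.2.2))
    (hFbin : ∀ p ∈ Fbin, ¬ W.holds (.binary p.1 p.2.1 p.2.2))
    (Tun Fun : Set (C × E)) (hun : Disjoint Tun Fun) :
    ∃ W' : BoxE.Config E C R (d + Fintype.card C),
      (∀ p ∈ Tbin, W'.holds (.binary p.1 p.2.1 p.2.2)) ∧
      (∀ p ∈ Fbin, ¬ W'.holds (.binary p.1 p.2.1 p.2.2)) ∧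
      (∀ q ∈ Tun, W'.holds (.unary q.1 q.2)) ∧
      (∀ q ∈ Fun, ¬ W'.holds (.unary q.1 q.2)) := by
  refine ⟨W.widenClasses.append (BoxE.Config.ofUnary Tun), fun p hp => ?_, fun p hp h => ?_,
    fun q hq => ?_, fun q hq h => ?_⟩
  · exact (BoxE.Config.holds_append ..).2
      ⟨(W.widenClasses_holds_binary ..).2 (hTbin p hp), BoxE.Config.ofUnary_holds_binary ..⟩
  · exact hFbin p hp <| (W.widenClasses_holds_binary ..).1 ((BoxE.Config.holds_append ..).1 h).1
  · exact (BoxE.Config.holds_append ..).2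
      ⟨W.widenClasses_holds_unary q.1 q.2, (BoxE.Config.ofUnary_holds_unary ..).2 hq⟩
  · exact hun.notMem_of_mem_left
      ((BoxE.Config.ofUnary_holds_unary ..).1 ((BoxE.Config.holds_append ..).1 h).2) hq
end

section
/- Full expressiveness for unary facts with one dimension per class: Let E and C be finite sets of entities and classes. For any disjoint sets T and F of unary facts over E and C, there exists an assignment of position vectors pos(e) ∈ ℝ^|C| to entities and boxes (l(c), u(c)) in ℝ^|C| to classes such that for every unary fact c(e): if c(e) ∈ T then pos(e) lies in the box of c, and if c(e) ∈ F then pos(e) does not lie in the box of c. Concretely, this is achieved by letting the box of the i-th class span [-1, 1] in coordinate i and an interval containing all entity position values in every other coordinate, and by setting the i-th coordinate of pos(e) to 0 if c_i(e) ∈ T and to 2 otherwise. -/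
/-- **full expressiveness for unary facts, one dimension per class.**
For finite `E` and `C` and any disjoint sets `T`, `F` of unary facts
(represented as class–entity pairs), there are positions in `ℝ^|C|` for the
entities and boxes in `ℝ^|C|` for the classes such that every fact of `T` is
true and every fact of `F` is false. -/
theorem unary_fully_expressive
    {E C : Type*} [Fintype E] [Fintype C]
    (T F : Set (C × E)) (hTF : Disjoint T F) :
    ∃ (pos : E → Fin (Fintype.card C) → ℝ)
      (l u : C → Fin (Fintype.card C) → ℝ),
      (∀ q ∈ T, BoxE.inBox (l q.1) (u q.1) (pos q.2)) ∧
      (∀ q ∈ F, ¬ BoxE.inBox (l q.1) (u q.1) (pos q.2)) := by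
  classical
  let idx := Fintype.equivFin C
  refine ⟨fun e k => if (idx.symm k, e) ∈ T then 0 else 2, fun _ _ => -1,
    fun c k => if k = idx c then 1 else 2, ?_, ?_⟩
  · rintro ⟨c, e⟩ hq k
    by_cases hk : k = idx c
    · subst hk
      simp [hq]
    · simp only [if_neg hk]
      split_ifs <;> norm_num
  · rintro ⟨c, e⟩ hq hbox
    have hnot : (c, e) ∉ T := fun hT => Set.disjoint_left.mp hTF hT hq
    have hle := (hbox (idx c)).2
    norm_num [hnot] at hle
end
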